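/- arXiv:1103.2697 — 2 statements merged into one kernel-verified Lean document; each statement's English description precedes it below -/
import Mathlib

section
/- Assume the design is orthonormal, i.e., XᵀX = I_p, let β̂ols = Xᵀy, and let β̂ be the unique global minimizer of the coop-Lasso objective L. Then for every k and every j ∈ G_k, ‖φ_j(β̂_{G_k})‖ = (‖φ_j(β̂ols_{G_k})‖ − λ w_k)⁺, where (t)⁺ = max(0, t). -/
open scoped BigOperators

/-- Euclidean norm of the positive part of `v` restricted to the index set `G`. -/
noncomputable def enormP {α : Type*} (G : Finset α) (v : α → ℝ) : ℝ :=
  Real.sqrt (∑ j ∈ G, (max (v j) 0) ^ 2)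

/-- Euclidean norm of the negative part of `v` restricted to the index set `G`. -/
noncomputable def enormN {α : Type*} (G : Finset α) (v : α → ℝ) : ℝ :=
  Real.sqrt (∑ j ∈ G, (max (-v j) 0) ^ 2)

/-- `‖φ_j(v_G)‖`: the Euclidean norm of `φ_j(v_G)`, where `φ_j(v) = 0` if `v j = 0`,
`φ_j(v) = v⁺` if `v j > 0` and `φ_j(v) = v⁻` if `v j < 0`. -/
noncomputable def phiNorm {α : Type*} (G : Finset α) (v : α → ℝ) (j : α) : ℝ :=
  if 0 < v j then enormP G v else if v j < 0 then enormN G v else 0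

/-- The cooperative-Lasso norm associated with groups `G k` and weights `w k`. -/
noncomputable def coopNorm {p K : ℕ} (G : Fin K → Finset (Fin p)) (w : Fin K → ℝ)
    (v : Fin p → ℝ) : ℝ :=
  ∑ k, w k * (enormP (G k) v + enormN (G k) v)

/-- The coop-Lasso objective `L(β) = (1/2)‖y − Xβ‖² + λ‖β‖_coop`. -/
noncomputable def coopObj {p K n : ℕ} (G : Fin K → Finset (Fin p)) (w : Fin K → ℝ)
    (X : Matrix (Fin n) (Fin p) ℝ) (y : Fin n → ℝ) (lam : ℝ) (β : Fin p → ℝ) : ℝ :=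
  (1 / 2) * (∑ i, (y i - Matrix.mulVec X β i) ^ 2) + lam * coopNorm G w β



/-- The shrinkage factor. -/
noncomputable def shrinkFac (c A : ℝ) : ℝ := max (1 - c / A) 0

lemma shrinkFac_nonneg (c A : ℝ) : 0 ≤ shrinkFac c A := le_max_right _ _

lemma shrinkFac_le_one {c A : ℝ} (hc : 0 ≤ c) (hA : 0 ≤ A) : shrinkFac c A ≤ 1 := by
  have : 0 ≤ c / A := by positivity
  exact max_le (by linarith) (by norm_num)

lemma shrinkFac_mul {c A : ℝ} (hc : 0 ≤ c) (hA : 0 ≤ A) :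
    shrinkFac c A * A = max (A - c) 0 := by
  unfold shrinkFac
  rcases hA.eq_or_lt with rfl | hA
  · simp [hc]
  · rw [max_mul_of_nonneg _ _ hA.le]
    congr 1
    · field_simp
    · simp

lemma one_sub_shrinkFac_mul_le {c A : ℝ} (hc : 0 ≤ c) (hA : 0 ≤ A) :
    (1 - shrinkFac c A) * A ≤ c := by
  have h := shrinkFac_mul hc hA
  have := le_max_left (A - c) 0
  nlinarith

lemma one_sub_shrinkFac_mul_eq {c A : ℝ} (hc : 0 ≤ c) (hA : 0 ≤ A) :
    (1 - shrinkFac c A) * shrinkFac c A * A ^ 2 = c * (shrinkFac c A * A) := by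
  have h := shrinkFac_mul hc hA
  have e : (1 - shrinkFac c A) * shrinkFac c A * A ^ 2
    = (A - shrinkFac c A * A) * (shrinkFac c A * A) := by ring
  rw [e, h]
  rcases le_total (A - c) 0 with h0 | h0
  · simp [max_eq_right h0]
  · rw [max_eq_left h0]; ring

lemma enormP_nonneg' {α : Type*} (G : Finset α) (v : α → ℝ) : 0 ≤ enormP G v := Real.sqrt_nonneg _
lemma enormN_nonneg' {α : Type*} (G : Finset α) (v : α → ℝ) : 0 ≤ enormN G v := Real.sqrt_nonneg _

lemma enormP_sq {α : Type*} (G : Finset α) (v : α → ℝ) :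
    enormP G v ^ 2 = ∑ j ∈ G, (max (v j) 0) ^ 2 :=
  Real.sq_sqrt (Finset.sum_nonneg fun _ _ => sq_nonneg _)
lemma enormN_sq {α : Type*} (G : Finset α) (v : α → ℝ) :
    enormN G v ^ 2 = ∑ j ∈ G, (max (-v j) 0) ^ 2 :=
  Real.sq_sqrt (Finset.sum_nonneg fun _ _ => sq_nonneg _)

lemma posPart_comb {s t : ℝ} (hs : 0 ≤ s) (ht : 0 ≤ t) (b : ℝ) :
    max (s * max b 0 - t * max (-b) 0) 0 = s * max b 0 := by
  rcases le_total b 0 with h | h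
  · have : 0 ≤ t * -b := mul_nonneg ht (by linarith)
    rw [max_eq_right h, max_eq_left (by linarith : (0:ℝ) ≤ -b), max_eq_right (by linarith)]
    ring
  · have : 0 ≤ s * b := mul_nonneg hs h
    rw [max_eq_left h, max_eq_right (by linarith : -b ≤ (0:ℝ)), max_eq_left (by linarith)]
    ring

lemma enormP_comb {α : Type*} (G : Finset α) (b v : α → ℝ) {s t : ℝ} (hs : 0 ≤ s) (ht : 0 ≤ t)
    (hv : ∀ j ∈ G, v j = s * max (b j) 0 - t * max (-b j) 0) :
    enormP G v = s * enormP G b := by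
  have h : ∑ j ∈ G, (max (v j) 0) ^ 2 = s ^ 2 * ∑ j ∈ G, (max (b j) 0) ^ 2 := by
    rw [Finset.mul_sum]
    refine Finset.sum_congr rfl fun j hj => ?_
    rw [hv j hj, posPart_comb hs ht, mul_pow]
  unfold enormP
  rw [h, Real.sqrt_mul (sq_nonneg s), Real.sqrt_sq hs]

lemma enormN_comb {α : Type*} (G : Finset α) (b v : α → ℝ) {s t : ℝ} (hs : 0 ≤ s) (ht : 0 ≤ t)
    (hv : ∀ j ∈ G, v j = s * max (b j) 0 - t * max (-b j) 0) :
    enormN G v = t * enormN G b := by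
  have := enormP_comb G (fun j => -b j) (fun j => -v j) ht hs
    (fun j hj => by rw [hv j hj, neg_neg]; ring)
  exact this

lemma term_ineq {s t : ℝ} (hs : s ≤ 1) (ht : t ≤ 1) (b u : ℝ) :
    (b - (s * max b 0 - t * max (-b) 0)) * (u - (s * max b 0 - t * max (-b) 0)) ≤
      (1 - s) * (max b 0 * max u 0) + (1 - t) * (max (-b) 0 * max (-u) 0)
      - (1 - s) * s * (max b 0) ^ 2 - (1 - t) * t * (max (-b) 0) ^ 2 := by
  have hu := le_max_left u 0
  have hu' := le_max_left (-u) 0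
  rcases le_total b 0 with h | h
  · rw [max_eq_right h, max_eq_left (by linarith : (0:ℝ) ≤ -b)]
    have : 0 ≤ (1 - t) * (-b) := mul_nonneg (by linarith) (by linarith)
    nlinarith [mul_le_mul_of_nonneg_left hu' this]
  · rw [max_eq_left h, max_eq_right (by linarith : -b ≤ (0:ℝ))]
    have : 0 ≤ (1 - s) * b := mul_nonneg (by linarith) h
    nlinarith [mul_le_mul_of_nonneg_left hu this]

lemma group_ineq {α : Type*} (G : Finset α) (b v u : α → ℝ) {c : ℝ} (hc : 0 ≤ c)
    (hv : ∀ j ∈ G, v j = shrinkFac c (enormP G b) * max (b j) 0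
      - shrinkFac c (enormN G b) * max (-b j) 0) :
    ∑ j ∈ G, (b j - v j) * (u j - v j) ≤
      c * (enormP G u + enormN G u) - c * (enormP G v + enormN G v) := by
  have hA := enormP_nonneg' G b
  have hB := enormN_nonneg' G b
  rw [enormP_comb G b v (shrinkFac_nonneg _ _) (shrinkFac_nonneg _ _) hv,
    enormN_comb G b v (shrinkFac_nonneg _ _) (shrinkFac_nonneg _ _) hv]
  have hs1 := shrinkFac_le_one hc hA
  have ht1 := shrinkFac_le_one hc hB
  have e1 := one_sub_shrinkFac_mul_eq hc hA
  have e2 := one_sub_shrinkFac_mul_eq hc hB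
  have i1 := one_sub_shrinkFac_mul_le hc hA
  have i2 := one_sub_shrinkFac_mul_le hc hB
  have cs1 : ∑ j ∈ G, max (b j) 0 * max (u j) 0 ≤ enormP G b * enormP G u :=
    Real.sum_mul_le_sqrt_mul_sqrt _ _ _
  have cs2 : ∑ j ∈ G, max (-b j) 0 * max (-u j) 0 ≤ enormN G b * enormN G u :=
    Real.sum_mul_le_sqrt_mul_sqrt _ _ _
  have q1 := enormP_sq G b
  have q2 := enormN_sq G b
  have hPu := enormP_nonneg' G u
  have hNu := enormN_nonneg' G u
  generalize shrinkFac c (enormP G b) = s at *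
  generalize shrinkFac c (enormN G b) = t at *
  have key : ∑ j ∈ G, (b j - v j) * (u j - v j) ≤ ∑ j ∈ G,
      ((1 - s) * (max (b j) 0 * max (u j) 0) + (1 - t) * (max (-b j) 0 * max (-u j) 0)
      - (1 - s) * s * (max (b j) 0) ^ 2 - (1 - t) * t * (max (-b j) 0) ^ 2) := by
    refine Finset.sum_le_sum fun j hj => ?_
    rw [hv j hj]
    exact term_ineq hs1 ht1 _ _
  simp only [Finset.sum_sub_distrib, Finset.sum_add_distrib, ← Finset.mul_sum] at key
  rw [← q1, ← q2, e1, e2] at key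
  have a1 := mul_le_mul_of_nonneg_left cs1 (sub_nonneg.2 hs1)
  have a2 := mul_le_mul_of_nonneg_left cs2 (sub_nonneg.2 ht1)
  have b1 := mul_le_mul_of_nonneg_right i1 hPu
  have b2 := mul_le_mul_of_nonneg_right i2 hNu
  nlinarith

lemma quad_expand {p n : ℕ} (X : Matrix (Fin n) (Fin p) ℝ) (y : Fin n → ℝ)
    (hX : X.transpose * X = 1) (b : Fin p → ℝ) (hols : ∀ j, b j = ∑ i, X i j * y i)
    (β : Fin p → ℝ) :
    ∑ i, (y i - Matrix.mulVec X β i) ^ 2 = ∑ i, y i ^ 2 - 2 * ∑ j, b j * β j + ∑ j, β j ^ 2 := by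
  have h1 : ∑ i, y i * Matrix.mulVec X β i = ∑ j, b j * β j := by
    simp only [Matrix.mulVec, dotProduct, Finset.mul_sum, hols, Finset.sum_mul]
    rw [Finset.sum_comm]
    exact Finset.sum_congr rfl fun _ _ => Finset.sum_congr rfl fun _ _ => by ring
  have h2 : ∑ i, Matrix.mulVec X β i ^ 2 = ∑ j, β j ^ 2 := by
    have : Matrix.mulVec X β ⬝ᵥ Matrix.mulVec X β = β ⬝ᵥ β := by
      rw [Matrix.dotProduct_mulVec, ← Matrix.mulVec_transpose, Matrix.mulVec_mulVec, hX,
        Matrix.one_mulVec]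
    simpa [dotProduct, pow_two] using this
  rw [← h1, ← h2, Finset.mul_sum, ← Finset.sum_sub_distrib, ← Finset.sum_add_distrib]
  exact Finset.sum_congr rfl fun _ _ => by ring

/-- under orthonormal design `XᵀX = I_p`, with `β̂ols = Xᵀy` and `β̂` the
unique global minimizer of the coop-Lasso objective, for every `k` and `j ∈ G_k`,
`‖φ_j(β̂_{G_k})‖ = (‖φ_j(β̂ols_{G_k})‖ − λ w_k)⁺`. -/
theorem coopLasso_orthonormal_phiNorm_shrinkage (p K n : ℕ) (hp : 1 ≤ p) (hpn : p ≤ n)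
    (G : Fin K → Finset (Fin p))
    (hcover : ∀ j : Fin p, ∃ k, j ∈ G k)
    (hdisj : ∀ k l : Fin K, k ≠ l → Disjoint (G k) (G l))
    (w : Fin K → ℝ) (hw : ∀ k, 0 < w k)
    (X : Matrix (Fin n) (Fin p) ℝ) (y : Fin n → ℝ)
    (hX : X.transpose * X = 1)
    (lam : ℝ) (hlam : 0 ≤ lam)
    (βols : Fin p → ℝ) (hols : ∀ j, βols j = ∑ i, X i j * y i)
    (βhat : Fin p → ℝ)
    (hmin : ∀ u : Fin p → ℝ, coopObj G w X y lam βhat ≤ coopObj G w X y lam u) :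
    ∀ k, ∀ j ∈ G k,
      phiNorm (G k) βhat j = max (phiNorm (G k) βols j - lam * w k) 0 := by
  choose κ hκ using hcover
  have hκu : ∀ k, ∀ j ∈ G k, κ j = k := by
    intro k j hj
    by_contra h
    exact Finset.disjoint_left.1 (hdisj _ _ h) (hκ j) hj
  have hc : ∀ k, 0 ≤ lam * w k := fun k => mul_nonneg hlam (hw k).le
  obtain ⟨v, hv⟩ : ∃ v : Fin p → ℝ, ∀ k, ∀ j ∈ G k,
      v j = shrinkFac (lam * w k) (enormP (G k) βols) * max (βols j) 0
      - shrinkFac (lam * w k) (enormN (G k) βols) * max (-βols j) 0 := by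
    refine ⟨fun j => shrinkFac (lam * w (κ j)) (enormP (G (κ j)) βols) * max (βols j) 0
      - shrinkFac (lam * w (κ j)) (enormN (G (κ j)) βols) * max (-βols j) 0, ?_⟩
    intro k j hj
    simp only [hκu k j hj]
  have hsum : ∀ f : Fin p → ℝ, ∑ j, f j = ∑ k, ∑ j ∈ G k, f j := by
    intro f
    rw [← Finset.sum_biUnion (fun k _ l _ h => hdisj k l h)]
    congr 1
    ext j
    simpa using ⟨κ j, hκ j⟩
  have hsub : ∑ j, (βols j - v j) * (βhat j - v j) ≤
      lam * coopNorm G w βhat - lam * coopNorm G w v := by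
    rw [hsum, coopNorm, coopNorm, Finset.mul_sum, Finset.mul_sum, ← Finset.sum_sub_distrib]
    refine Finset.sum_le_sum fun k _ => ?_
    have := group_ineq (G k) βols v βhat (hc k) (hv k)
    linarith
  have hm := hmin v
  rw [coopObj, coopObj, quad_expand X y hX βols hols, quad_expand X y hX βols hols] at hm
  have hid : ∑ j, (βhat j - v j) ^ 2 = (∑ j, βhat j ^ 2 - 2 * ∑ j, βols j * βhat j)
      - (∑ j, v j ^ 2 - 2 * ∑ j, βols j * v j)
      + 2 * ∑ j, (βols j - v j) * (βhat j - v j) := by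
    simp only [Finset.mul_sum, ← Finset.sum_sub_distrib, ← Finset.sum_add_distrib]
    exact Finset.sum_congr rfl fun _ _ => by ring
  have hz : ∑ j, (βhat j - v j) ^ 2 = 0 :=
    le_antisymm (by linarith) (Finset.sum_nonneg fun _ _ => sq_nonneg _)
  have heq : βhat = v := by
    funext j
    have := (Finset.sum_eq_zero_iff_of_nonneg (fun _ _ => sq_nonneg _)).1 hz j (Finset.mem_univ j)
    nlinarith [pow_eq_zero_iff (two_ne_zero) |>.1 this]
  subst heq
  intro k j hj
  have hP := enormP_comb (G k) βols βhat (shrinkFac_nonneg _ _) (shrinkFac_nonneg _ _) (hv k)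
  have hN := enormN_comb (G k) βols βhat (shrinkFac_nonneg _ _) (shrinkFac_nonneg _ _) (hv k)
  rw [shrinkFac_mul (hc k) (enormP_nonneg' _ _)] at hP
  rw [shrinkFac_mul (hc k) (enormN_nonneg' _ _)] at hN
  have hPs := shrinkFac_mul (hc k) (enormP_nonneg' (G k) βols)
  have hNs := shrinkFac_mul (hc k) (enormN_nonneg' (G k) βols)
  have hvj := hv k j hj
  have hs0 := shrinkFac_nonneg (lam * w k) (enormP (G k) βols)
  have ht0 := shrinkFac_nonneg (lam * w k) (enormN (G k) βols)
  generalize shrinkFac (lam * w k) (enormP (G k) βols) = s at *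
  generalize shrinkFac (lam * w k) (enormN (G k) βols) = t at *
  unfold phiNorm
  rcases lt_trichotomy (βols j) 0 with h | h | h
  · rw [max_eq_right h.le, max_eq_left (by linarith : (0:ℝ) ≤ -βols j)] at hvj
    rw [if_neg (not_lt.2 h.le), if_pos h]
    rcases ht0.eq_or_lt with h0 | h0
    · have hb : βhat j = 0 := by rw [hvj, ← h0]; ring
      rw [← hNs, ← h0]
      simp [hb]
    · have hb : βhat j < 0 := by rw [hvj]; nlinarith
      rw [if_neg (not_lt.2 hb.le), if_pos hb, hN]
  · have hb : βhat j = 0 := by rw [hvj, h]; simp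
    simp [hb, h, hc k]
  · rw [max_eq_left h.le, max_eq_right (by linarith : -βols j ≤ (0:ℝ))] at hvj
    rw [if_pos h]
    rcases hs0.eq_or_lt with h0 | h0
    · have hb : βhat j = 0 := by rw [hvj, ← h0]; ring
      rw [← hPs, ← h0]
      simp [hb]
    · have hb : 0 < βhat j := by rw [hvj]; nlinarith [mul_pos h0 h]
      rw [if_pos hb, hP]
end

section
/- Assume the design is orthonormal, i.e., XᵀX = I_p, let β̂ols = Xᵀy, and let β̂group be the unique global minimizer of the group-Lasso objective β ↦ (1/2)‖y − Xβ‖² + λ‖β‖_group. Then for every k and every j ∈ G_k: β̂group_j = 0 if β̂ols_{G_k} = 0, and otherwise β̂group_j = (1 − λ w_k / ‖β̂ols_{G_k}‖)⁺ · β̂ols_j; consequently ‖β̂group_{G_k}‖ = (‖β̂ols_{G_k}‖ − λ w_k)⁺, where (t)⁺ = max(0, t). -/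
open scoped BigOperators

/-- Euclidean norm of `v` restricted to the index set `G`. -/
noncomputable def enorm {α : Type*} (G : Finset α) (v : α → ℝ) : ℝ :=
  Real.sqrt (∑ j ∈ G, (v j) ^ 2)

/-- The group-Lasso norm associated with groups `G k` and weights `w k`. -/
noncomputable def groupNorm {p K : ℕ} (G : Fin K → Finset (Fin p)) (w : Fin K → ℝ)
    (v : Fin p → ℝ) : ℝ :=
  ∑ k, w k * enorm (G k) v

/-- The group-Lasso objective `(1/2)‖y − Xβ‖² + λ‖β‖_group`. -/
noncomputable def groupObj {p K n : ℕ} (G : Fin K → Finset (Fin p)) (w : Fin K → ℝ)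
    (X : Matrix (Fin n) (Fin p) ℝ) (y : Fin n → ℝ) (lam : ℝ) (β : Fin p → ℝ) : ℝ :=
  (1 / 2) * (∑ i, (y i - Matrix.mulVec X β i) ^ 2) + lam * groupNorm G w β

theorem gl_enorm_sq {α : Type*} (G : Finset α) (v : α → ℝ) :
    (enorm G v : ℝ) ^ 2 = ∑ j ∈ G, (v j) ^ 2 :=
  Real.sq_sqrt (Finset.sum_nonneg fun _ _ => sq_nonneg _)

theorem gl_enorm_nonneg {α : Type*} (G : Finset α) (v : α → ℝ) :
    (0 : ℝ) ≤ enorm G v := Real.sqrt_nonneg _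

theorem gl_enorm_smul {α : Type*} (G : Finset α) (v b : α → ℝ) (s : ℝ) (hs : 0 ≤ s)
    (hb : ∀ j ∈ G, b j = s * v j) : (enorm G b : ℝ) = s * enorm G v := by
  have h : ∑ j ∈ G, (b j) ^ 2 = s ^ 2 * ∑ j ∈ G, (v j) ^ 2 := by
    rw [Finset.mul_sum]
    refine Finset.sum_congr rfl fun j hj => ?_
    rw [hb j hj]; ring
  show Real.sqrt _ = s * Real.sqrt _
  rw [h, Real.sqrt_mul (sq_nonneg s), Real.sqrt_sq hs]

theorem gl_inner_le {α : Type*} (G : Finset α) (u v : α → ℝ) :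
    ∑ j ∈ G, u j * v j ≤ (enorm G u : ℝ) * enorm G v :=
  Real.sum_mul_le_sqrt_mul_sqrt G u v

theorem gl_shrink (N c : ℝ) (hN : 0 ≤ N) (hc : 0 ≤ c) :
    max (1 - c / N) 0 ≤ 1 ∧ (1 - max (1 - c / N) 0) * N ≤ c ∧
    max (1 - c / N) 0 * N * ((1 - max (1 - c / N) 0) * N - c) = 0 ∧
    max (1 - c / N) 0 * N = max (N - c) 0 := by
  have h0 : 0 ≤ c / N := div_nonneg hc hN
  rcases hN.eq_or_lt with rfl | hN
  · simp [hc]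
  · have h : c / N * N = c := div_mul_cancel₀ c hN.ne'
    rcases le_total (1 - c / N) 0 with h1 | h1
    · have : N - c ≤ 0 := by nlinarith
      rw [max_eq_right h1, max_eq_right this]
      refine ⟨by norm_num, by linarith, by ring, by ring⟩
    · have : 0 ≤ N - c := by nlinarith
      rw [max_eq_left h1, max_eq_left this]
      refine ⟨by linarith, by linarith, ?_, by linarith⟩
      have : (1 - (1 - c / N)) * N - c = 0 := by linarith
      rw [this, mul_zero]

theorem gl_group {α : Type*} (G : Finset α) (z u b : α → ℝ) (c : ℝ) (hc : 0 ≤ c)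
    (hb : ∀ j ∈ G, b j = max (1 - c / (enorm G z : ℝ)) 0 * z j) :
    (1 / 2) * ∑ j ∈ G, (z j - b j) ^ 2 + c * enorm G b + (1 / 2) * ∑ j ∈ G, (u j - b j) ^ 2
      ≤ (1 / 2) * ∑ j ∈ G, (z j - u j) ^ 2 + c * enorm G u := by
  obtain ⟨h1, h2, h3, -⟩ := gl_shrink (enorm G z) c (gl_enorm_nonneg G z) hc
  have h0 : 0 ≤ max (1 - c / (enorm G z : ℝ)) 0 := le_max_right _ _
  rw [gl_enorm_smul G z b _ h0 hb]
  generalize max (1 - c / (enorm G z : ℝ)) 0 = s at *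
  have e1 : ∑ j ∈ G, (z j - b j) ^ 2 = (1 - s) ^ 2 * (enorm G z : ℝ) ^ 2 := by
    rw [gl_enorm_sq, Finset.mul_sum]
    refine Finset.sum_congr rfl fun j hj => ?_
    rw [hb j hj]; ring
  have e2 : ∑ j ∈ G, (u j - b j) ^ 2 =
      (enorm G u : ℝ) ^ 2 - 2 * s * ∑ j ∈ G, z j * u j + s ^ 2 * (enorm G z : ℝ) ^ 2 := by
    rw [gl_enorm_sq, gl_enorm_sq, Finset.mul_sum, Finset.mul_sum, ← Finset.sum_sub_distrib,
      ← Finset.sum_add_distrib]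
    refine Finset.sum_congr rfl fun j hj => ?_
    rw [hb j hj]; ring
  have e3 : ∑ j ∈ G, (z j - u j) ^ 2 =
      (enorm G z : ℝ) ^ 2 - 2 * ∑ j ∈ G, z j * u j + (enorm G u : ℝ) ^ 2 := by
    rw [gl_enorm_sq, gl_enorm_sq, Finset.mul_sum, ← Finset.sum_sub_distrib,
      ← Finset.sum_add_distrib]
    refine Finset.sum_congr rfl fun j hj => ?_
    ring
  have hI := gl_inner_le G z u
  have hM := gl_enorm_nonneg G u
  rw [e1, e2, e3]
  have a1 := mul_le_mul_of_nonneg_left hI (sub_nonneg.2 h1)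
  have a2 := mul_le_mul_of_nonneg_right h2 hM
  nlinarith

theorem gl_sum_groups {p K : ℕ} (G : Fin K → Finset (Fin p))
    (hcover : ∀ j : Fin p, ∃ k, j ∈ G k)
    (hdisj : ∀ k l : Fin K, k ≠ l → Disjoint (G k) (G l)) (f : Fin p → ℝ) :
    ∑ j, f j = ∑ k, ∑ j ∈ G k, f j := by
  rw [← Finset.sum_biUnion (fun k _ l _ h => hdisj k l h)]
  refine Finset.sum_congr ?_ fun _ _ => rfl
  ext j
  simpa using hcover j

theorem gl_fit {p n : ℕ} (X : Matrix (Fin n) (Fin p) ℝ) (y : Fin n → ℝ)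
    (hX : X.transpose * X = 1) (z : Fin p → ℝ) (hz : ∀ j, z j = ∑ i, X i j * y i)
    (β : Fin p → ℝ) :
    ∑ i, (y i - Matrix.mulVec X β i) ^ 2 =
      (∑ i, y i ^ 2 - ∑ j, z j ^ 2) + ∑ j, (z j - β j) ^ 2 := by
  have h1 : ∑ i, y i * Matrix.mulVec X β i = ∑ j, z j * β j := by
    simp only [Matrix.mulVec, dotProduct, hz, Finset.mul_sum, Finset.sum_mul]
    rw [Finset.sum_comm]
    exact Finset.sum_congr rfl fun _ _ => Finset.sum_congr rfl fun _ _ => by ring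
  have h2 : ∑ i, Matrix.mulVec X β i ^ 2 = ∑ j, β j ^ 2 := by
    have : dotProduct (Matrix.mulVec X β) (Matrix.mulVec X β) = dotProduct β β := by
      rw [Matrix.dotProduct_mulVec, ← Matrix.mulVec_transpose, Matrix.mulVec_mulVec, hX,
        Matrix.one_mulVec]
    simpa [dotProduct, sq] using this
  have h3 : ∑ i, (y i - Matrix.mulVec X β i) ^ 2 = ∑ i, y i ^ 2
      - 2 * ∑ i, y i * Matrix.mulVec X β i + ∑ i, Matrix.mulVec X β i ^ 2 := by
    rw [Finset.mul_sum, ← Finset.sum_sub_distrib, ← Finset.sum_add_distrib]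
    exact Finset.sum_congr rfl fun _ _ => by ring
  have h4 : ∑ j, (z j - β j) ^ 2 = ∑ j, z j ^ 2 - 2 * ∑ j, z j * β j + ∑ j, β j ^ 2 := by
    rw [Finset.mul_sum, ← Finset.sum_sub_distrib, ← Finset.sum_add_distrib]
    exact Finset.sum_congr rfl fun _ _ => by ring
  rw [h3, h4, h1, h2]; ring

/-- closed-form of the group-Lasso estimate under orthonormal design
`XᵀX = I_p`: with `β̂ols = Xᵀy`, the global minimizer `β̂group` satisfies
`β̂group_j = 0` when `β̂ols_{G_k} = 0`, otherwise
`β̂group_j = (1 − λ w_k/‖β̂ols_{G_k}‖)⁺ β̂ols_j`; consequently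
`‖β̂group_{G_k}‖ = (‖β̂ols_{G_k}‖ − λ w_k)⁺`. -/
theorem groupLasso_orthonormal_closed_form (p K n : ℕ) (hp : 1 ≤ p) (hpn : p ≤ n)
    (G : Fin K → Finset (Fin p))
    (hcover : ∀ j : Fin p, ∃ k, j ∈ G k)
    (hdisj : ∀ k l : Fin K, k ≠ l → Disjoint (G k) (G l))
    (w : Fin K → ℝ) (hw : ∀ k, 0 < w k)
    (X : Matrix (Fin n) (Fin p) ℝ) (y : Fin n → ℝ)
    (hX : X.transpose * X = 1)
    (lam : ℝ) (hlam : 0 ≤ lam)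
    (βols : Fin p → ℝ) (hols : ∀ j, βols j = ∑ i, X i j * y i)
    (βhat : Fin p → ℝ)
    (hmin : ∀ u : Fin p → ℝ, groupObj G w X y lam βhat ≤ groupObj G w X y lam u) :
    ∀ k, ((∀ j ∈ G k,
        ((∀ l ∈ G k, βols l = 0) → βhat j = 0) ∧
        ((∃ l ∈ G k, βols l ≠ 0) →
          βhat j = max (1 - lam * w k / enorm (G k) βols) 0 * βols j)) ∧
      enorm (G k) βhat = max (enorm (G k) βols - lam * w k) 0) := by
  have hc : ∀ k, 0 ≤ lam * w k := fun k => mul_nonneg hlam (hw k).le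
  choose κ hκ using hcover
  have hκ' : ∀ k, ∀ j ∈ G k, κ j = k := by
    intro k j hj
    by_contra h
    exact Finset.disjoint_left.1 (hdisj _ _ h) (hκ j) hj
  obtain ⟨b, hb⟩ : ∃ b : Fin p → ℝ, ∀ k, ∀ j ∈ G k,
      b j = max (1 - lam * w k / (enorm (G k) βols : ℝ)) 0 * βols j := by
    refine ⟨fun j => max (1 - lam * w (κ j) / (enorm (G (κ j)) βols : ℝ)) 0 * βols j, ?_⟩
    intro k j hj
    simp only [hκ' k j hj]
  have hsum := Finset.sum_le_sum fun k (_ : k ∈ Finset.univ) =>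
    gl_group (G k) βols βhat b (lam * w k) (hc k) (hb k)
  have hobj : ∀ β, groupObj G w X y lam β = (1 / 2) * (∑ i, y i ^ 2 - ∑ j, βols j ^ 2) +
      ∑ k, ((1 / 2) * ∑ j ∈ G k, (βols j - β j) ^ 2 + lam * w k * enorm (G k) β) := by
    intro β
    unfold groupObj groupNorm
    rw [gl_fit X y hX βols hols, gl_sum_groups G (fun j => ⟨κ j, hκ j⟩) hdisj
      (fun j => (βols j - β j) ^ 2), Finset.sum_add_distrib, ← Finset.mul_sum, Finset.mul_sum _ _ lam]
    simp only [mul_assoc]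
    ring
  have hm := hmin b
  rw [hobj, hobj] at hm
  rw [Finset.sum_add_distrib (f := fun k => (1 / 2) * ∑ j ∈ G k, (βols j - b j) ^ 2
    + lam * w k * enorm (G k) b), ← Finset.mul_sum,
    ← gl_sum_groups G (fun j => ⟨κ j, hκ j⟩) hdisj (fun j => (βhat j - b j) ^ 2)] at hsum
  have hz : ∑ j, (βhat j - b j) ^ 2 = 0 :=
    le_antisymm (by linarith) (Finset.sum_nonneg fun _ _ => sq_nonneg _)
  rw [Finset.sum_eq_zero_iff_of_nonneg fun _ _ => sq_nonneg _] at hz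
  have heq : ∀ j, βhat j = b j := fun j => by
    have := pow_eq_zero_iff (two_ne_zero) |>.1 (hz j (Finset.mem_univ j))
    linarith
  intro k
  refine ⟨fun j hj => ⟨fun h => ?_, fun _ => ?_⟩, ?_⟩
  · rw [heq, hb k j hj, h j hj, mul_zero]
  · rw [heq, hb k j hj]
  · rw [gl_enorm_smul (G k) βols βhat _ (le_max_right _ _) (fun j hj => (heq j).trans (hb k j hj))]
    exact (gl_shrink _ _ (gl_enorm_nonneg _ _) (hc k)).2.2.2
end
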